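/- If X_1, …, X_n possess cardinality symmetry, then for every y ∈ ℝ̄, 1 − F_Y(y) = Σ_{s=0}^n g_y(s) · #{S ⊆ {1,…,n} : |S| = s and w(S) > y}. -/

import Mathlib

open MeasureTheory Finset

/-- A weighted lattice polynomial exceeds `y` exactly when the weight of the set of coordinates
exceeding `y` does. -/
lemma lt_iSup_inf_iInf_iff {ι α : Type*} [Fintype ι] [CompleteLinearOrder α]
    {w : Finset ι → α} (hw : Monotone w) (x : ι → α) (y : α) :
    y < (⨆ S : Finset ι, w S ⊓ ⨅ i ∈ S, x i) ↔ y < w {i | y < x i} := by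
  have key (S : Finset ι) (hy : y < ⊤) : (y < ⨅ i ∈ S, x i) ↔ ∀ i ∈ S, y < x i := by
    rw [← Finset.inf_eq_iInf, Finset.lt_inf_iff hy]
  simp only [lt_iSup_iff, lt_inf_iff]
  constructor
  · rintro ⟨S, hS, hx⟩
    refine hS.trans_le (hw fun i hi ↦ ?_)
    simpa using (key S (hS.trans_le le_top)).1 hx i hi
  · intro h
    exact ⟨_, h, (key _ (h.trans_le le_top)).2 fun i hi ↦ by simpa using hi⟩

/-- under cardinality symmetry (`ℙ(S_y = S)` depends only on `|S|`, with
common value `g y |S|`), `1 − F_Y(y) = Σ_{s=0}^n g_y(s) · #{S : |S| = s, w(S) > y}`. -/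
theorem stmt_16 {n : ℕ} (hn : 1 ≤ n) {Ω : Type*} [MeasurableSpace Ω]
    (ℙ : Measure Ω) [IsProbabilityMeasure ℙ]
    (X : Fin n → Ω → EReal) (hX : ∀ i, Measurable (X i))
    (hsym : ∀ (y : EReal) (S S' : Finset (Fin n)), S.card = S'.card →
      ℙ {ω | ∀ i, X i ω > y ↔ i ∈ S} = ℙ {ω | ∀ i, X i ω > y ↔ i ∈ S'})
    (g : EReal → ℕ → ℝ)
    (hg : ∀ (y : EReal) (S : Finset (Fin n)),
      g y S.card = (ℙ {ω | ∀ i, X i ω > y ↔ i ∈ S}).toReal)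
    (w : Finset (Fin n) → EReal) (hw : ∀ S T : Finset (Fin n), S ⊆ T → w S ≤ w T)
    (Y : Ω → EReal) (hY : ∀ ω, Y ω = ⨆ S : Finset (Fin n), (w S ⊓ ⨅ i ∈ S, X i ω))
    (y : EReal) :
    1 - (ℙ {ω | Y ω ≤ y}).toReal =
      ∑ s ∈ Finset.range (n + 1),
        g y s *
          ((Finset.univ.filter
            (fun S : Finset (Fin n) => S.card = s ∧ w S > y)).card : ℝ) := by
  classical
  have hmeas (S : Finset (Fin n)) : MeasurableSet {ω | ∀ i, X i ω > y ↔ i ∈ S} := by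
    simp only [Set.ofPred_forall]
    refine MeasurableSet.iInter fun i ↦ ?_
    exact (measurableSet_lt measurable_const (hX i)).iff (.const _)
  have hevent : {ω | Y ω ≤ y}ᶜ = ⋃ S ∈ (univ.filter fun S : Finset (Fin n) ↦ w S > y),
      {ω | ∀ i, X i ω > y ↔ i ∈ S} := by
    ext ω
    have h := lt_iSup_inf_iInf_iff (fun S T h ↦ hw S T h) (fun i ↦ X i ω) y
    rw [← hY ω] at h
    simp only [Set.mem_compl_iff, Set.mem_ofPred_eq, not_le, h, Set.mem_iUnion, mem_filter,
      mem_univ, true_and, exists_prop]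
    constructor
    · exact fun h ↦ ⟨_, h, fun i ↦ by simp⟩
    · rintro ⟨S, hS, hi⟩
      convert hS
      ext i
      simpa using hi i
  have hdisj : Set.PairwiseDisjoint (↑(univ.filter fun S : Finset (Fin n) ↦ w S > y))
      fun S : Finset (Fin n) ↦ {ω | ∀ i, X i ω > y ↔ i ∈ S} := by
    intro S _ T _ hST
    refine Set.disjoint_left.2 fun ω h₁ h₂ ↦ hST ?_
    ext i
    exact (h₁ i).symm.trans (h₂ i)
  have hY_meas : MeasurableSet {ω | Y ω ≤ y} := by
    rw [← MeasurableSet.compl_iff, hevent]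
    exact Finset.measurableSet_biUnion _ fun S _ ↦ hmeas S
  change 1 - ℙ.real {ω | Y ω ≤ y} = _
  rw [← probReal_compl_eq_one_sub hY_meas, hevent,
    measureReal_biUnion_finset hdisj fun S _ ↦ hmeas S,
    ← Finset.sum_fiberwise_of_maps_to (t := Finset.range (n + 1)) (g := Finset.card)]
  · refine Finset.sum_congr rfl fun s _ ↦ ?_
    rw [Finset.filter_filter, mul_comm, ← nsmul_eq_mul, ← Finset.sum_const]
    simp only [and_comm (b := _ = s)]
    refine Finset.sum_congr rfl fun S hS ↦ ?_
    rw [← (mem_filter.1 hS).2.1, hg]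
    rfl
  · intro S _
    simpa [Nat.lt_succ_iff] using S.card_le_univ
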